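/- Let (E, {f_i}_{i=1}^m) ∈ 𝓔 with convex hull I. If f_1(I) ∩ f_2(I) ≠ ∅ but f_{m−1}(I) ∩ f_m(I) = ∅, then for every integer k ≥ 1, dim_H U_k(E) ≥ dim_H U_1(E). -/

import Mathlib

open Set Filter MeasureTheory

/-- A self-similar iterated function system on `ℝ` given by `m` similitudes
`f i x = r i * x + t i` (for `1 ≤ i ≤ m`, `m ≥ 3`), together with its attractor `E`:
the unique nonempty compact set with `E = ⋃_{i=1}^m f_i(E)`. -/
structure ClassE where
  m : ℕ
  r : ℕ → ℝ
  t : ℕ → ℝ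
  E : Set ℝ
  hm : 3 ≤ m
  hr : ∀ i, 1 ≤ i → i ≤ m → 0 < r i ∧ r i < 1
  hEne : E.Nonempty
  hEcpt : IsCompact E
  hEinv : E = ⋃ i ∈ Finset.Icc 1 m, (fun x => r i * x + t i) '' E

namespace ClassE

/-- The `i`-th similitude. -/
def f (S : ClassE) (i : ℕ) (x : ℝ) : ℝ := S.r i * x + S.t i

/-- Left endpoint `a` of the convex hull of `E`. -/
noncomputable def a (S : ClassE) : ℝ := sInf S.E

/-- Right endpoint `b` of the convex hull of `E`. -/
noncomputable def b (S : ClassE) : ℝ := sSup S.E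

/-- The convex hull `I = [a, b]` of `E`. -/
noncomputable def I (S : ClassE) : Set ℝ := Set.Icc S.a S.b

/-- Condition (A): `a = f_1(a) < f_2(a) < ⋯ < f_m(a) < f_m(b) = b`. -/
def condA (S : ClassE) : Prop :=
  S.f 1 S.a = S.a ∧ (∀ i, 1 ≤ i → i < S.m → S.f i S.a < S.f (i + 1) S.a) ∧
    S.f S.m S.a < S.f S.m S.b ∧ S.f S.m S.b = S.b

/-- Condition (B): `f_i(I) ∩ f_{i+2}(I) = ∅` for all `1 ≤ i ≤ m - 2`. -/
def condB (S : ClassE) : Prop :=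
  ∀ i, 1 ≤ i → i + 2 ≤ S.m → S.f i '' S.I ∩ S.f (i + 2) '' S.I = ∅

/-- Condition (C): there are `i, j ∈ {1, …, m-1}` with `f_i(I) ∩ f_{i+1}(I) = ∅` and
`f_j(I) ∩ f_{j+1}(I) ≠ ∅`. -/
def condC (S : ClassE) : Prop :=
  (∃ i, 1 ≤ i ∧ i + 1 ≤ S.m ∧ S.f i '' S.I ∩ S.f (i + 1) '' S.I = ∅) ∧
    (∃ j, 1 ≤ j ∧ j + 1 ≤ S.m ∧ S.f j '' S.I ∩ S.f (j + 1) '' S.I ≠ ∅)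

/-- Condition (D): whenever `f_i(I) ∩ f_{i+1}(I) ≠ ∅` there are `u, v ≥ 1` with
`f_i(I) ∩ f_{i+1}(I) = f_i ∘ f_m^u (I) = f_{i+1} ∘ f_1^v (I)`. -/
def condD (S : ClassE) : Prop :=
  ∀ i, 1 ≤ i → i + 1 ≤ S.m → S.f i '' S.I ∩ S.f (i + 1) '' S.I ≠ ∅ →
    ∃ u v : ℕ, 1 ≤ u ∧ 1 ≤ v ∧
      S.f i '' S.I ∩ S.f (i + 1) '' S.I = (S.f i ∘ (S.f S.m)^[u]) '' S.I ∧
      S.f i '' S.I ∩ S.f (i + 1) '' S.I = (S.f (i + 1) ∘ (S.f 1)^[v]) '' S.I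

/-- Membership in the class `𝓔`: conditions (A)–(D). -/
def goodE (S : ClassE) : Prop := S.condA ∧ S.condB ∧ S.condC ∧ S.condD

/-- `prefixMap d n = f_{d 0} ∘ f_{d 1} ∘ ⋯ ∘ f_{d (n-1)}`. -/
def prefixMap (S : ClassE) (d : ℕ → ℕ) : ℕ → ℝ → ℝ
  | 0 => id
  | n + 1 => S.prefixMap d n ∘ S.f (d n)

/-- `d : ℕ → ℕ` (with digits in `{1, …, m}`) is a coding of `x` if
`x = lim_n f_{d 0} ∘ ⋯ ∘ f_{d (n-1)} (0)`. -/
def isCoding (S : ClassE) (d : ℕ → ℕ) (x : ℝ) : Prop :=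
  (∀ n, 1 ≤ d n ∧ d n ≤ S.m) ∧
    Tendsto (fun n => S.prefixMap d n 0) atTop (nhds x)

/-- The set of codings of `x`. -/
def codings (S : ClassE) (x : ℝ) : Set (ℕ → ℕ) := {d | S.isCoding d x}

/-- `U k E`: the set of points of `E` having exactly `k` distinct codings
(`k` a cardinal; e.g. `k = ℵ₀` for countably infinitely many codings,
`k = 𝔠 = 2^ℵ₀` for a continuum of codings). -/
def U (S : ClassE) (k : Cardinal) : Set ℝ :=
  {x ∈ S.E | Cardinal.mk (S.codings x) = k}

end ClassE

namespace ClassE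

def tcons (i : ℕ) (d : ℕ → ℕ) : ℕ → ℕ
  | 0 => i
  | n + 1 => d n

lemma tcons_inj (i : ℕ) : Function.Injective (tcons i) := by
  intro d e h
  funext n
  exact congrFun h (n + 1)

lemma tcons_eta (d : ℕ → ℕ) : tcons (d 0) (fun n => d (n + 1)) = d := by
  funext n
  cases n <;> rfl

lemma prefixMap_tcons (S : ClassE) (i : ℕ) (d : ℕ → ℕ) (n : ℕ) (x : ℝ) :
    S.prefixMap (tcons i d) (n + 1) x = S.f i (S.prefixMap d n x) := by
  induction n generalizing x with
  | zero => rfl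
  | succ n ih =>
    have h1 : S.prefixMap (tcons i d) (n + 1 + 1) x
      = S.prefixMap (tcons i d) (n + 1) (S.f (d n) x) := rfl
    have h2 : S.prefixMap d (n + 1) x = S.prefixMap d n (S.f (d n) x) := rfl
    rw [h1, h2, ih]

lemma isCoding_tcons (S : ClassE) (i : ℕ) (hi : 1 ≤ i) (hi' : i ≤ S.m) (d : ℕ → ℕ) (x : ℝ) :
    S.isCoding (tcons i d) (S.f i x) ↔ S.isCoding d x := by
  have hr := (S.hr i hi hi').1
  unfold isCoding
  constructor
  · rintro ⟨h1, h2⟩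
    refine ⟨fun n => h1 (n + 1), ?_⟩
    rw [← tendsto_add_atTop_iff_nat 1] at h2
    simp only [prefixMap_tcons] at h2
    have h3 := (h2.sub_const (S.t i)).div_const (S.r i)
    have key : ∀ y, (S.f i y - S.t i) / S.r i = y := by
      intro y
      unfold f
      field_simp
      ring
    simpa only [key] using h3
  · rintro ⟨h1, h2⟩
    refine ⟨fun n => ?_, ?_⟩
    · cases n with
      | zero => exact ⟨hi, hi'⟩
      | succ n => exact h1 n
    · rw [← tendsto_add_atTop_iff_nat 1]
      simp only [prefixMap_tcons]
      exact (h2.const_mul (S.r i)).add_const (S.t i)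

lemma f_mem_E (S : ClassE) {i : ℕ} (hi : 1 ≤ i) (hi' : i ≤ S.m) {x : ℝ} (hx : x ∈ S.E) :
    S.f i x ∈ S.E := by
  rw [S.hEinv]
  simp only [Set.mem_iUnion]
  exact ⟨i, by simp [hi, hi'], x, hx, rfl⟩

lemma mem_E_cases (S : ClassE) {x : ℝ} (hx : x ∈ S.E) :
    ∃ i, 1 ≤ i ∧ i ≤ S.m ∧ ∃ y ∈ S.E, S.f i y = x := by
  rw [S.hEinv] at hx
  simp only [Set.mem_iUnion] at hx
  obtain ⟨i, hi, y, hy, h⟩ := hx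
  rw [Finset.mem_Icc] at hi
  exact ⟨i, hi.1, hi.2, y, hy, h⟩

lemma exists_rho (S : ClassE) : ∃ ρ : ℝ, 0 ≤ ρ ∧ ρ < 1 ∧ ∀ i, 1 ≤ i → i ≤ S.m → S.r i ≤ ρ := by
  have hne : (Finset.Icc 1 S.m).Nonempty := ⟨1, by have := S.hm; simp; omega⟩
  obtain ⟨j, hj, hmax⟩ := Finset.exists_max_image (Finset.Icc 1 S.m) S.r hne
  rw [Finset.mem_Icc] at hj
  refine ⟨S.r j, (S.hr j hj.1 hj.2).1.le, (S.hr j hj.1 hj.2).2, fun i h h' => hmax i ?_⟩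
  simp [h, h']

lemma prefixMap_mem (S : ClassE) (d : ℕ → ℕ) (hd : ∀ n, 1 ≤ d n ∧ d n ≤ S.m) (n : ℕ) :
    ∀ e ∈ S.E, S.prefixMap d n e ∈ S.E := by
  induction n with
  | zero => intro e he; exact he
  | succ n ih => intro e he; exact ih _ (S.f_mem_E (hd n).1 (hd n).2 he)

lemma prefixMap_dist (S : ClassE) (d : ℕ → ℕ) (hd : ∀ n, 1 ≤ d n ∧ d n ≤ S.m) (ρ : ℝ)
    (h0 : 0 ≤ ρ) (hρ : ∀ i, 1 ≤ i → i ≤ S.m → S.r i ≤ ρ) (n : ℕ) :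
    ∀ x y, |S.prefixMap d n x - S.prefixMap d n y| ≤ ρ ^ n * |x - y| := by
  induction n with
  | zero => intro x y; simp [prefixMap]
  | succ n ih =>
    intro x y
    have h1 : |S.f (d n) x - S.f (d n) y| ≤ ρ * |x - y| := by
      have : S.f (d n) x - S.f (d n) y = S.r (d n) * (x - y) := by unfold f; ring
      rw [this, abs_mul, abs_of_pos (S.hr _ (hd n).1 (hd n).2).1]
      exact mul_le_mul_of_nonneg_right (hρ _ (hd n).1 (hd n).2) (abs_nonneg _)
    calc _ ≤ ρ ^ n * |S.f (d n) x - S.f (d n) y| := ih _ _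
      _ ≤ ρ ^ n * (ρ * |x - y|) := mul_le_mul_of_nonneg_left h1 (pow_nonneg h0 n)
      _ = _ := by ring

lemma isCoding_mem (S : ClassE) {d : ℕ → ℕ} {x : ℝ} (h : S.isCoding d x) : x ∈ S.E := by
  obtain ⟨hd, hx⟩ := h
  obtain ⟨ρ, h0, h1, hρ⟩ := S.exists_rho
  obtain ⟨e, he⟩ := S.hEne
  have hz : Tendsto (fun n => S.prefixMap d n e - S.prefixMap d n 0) atTop (nhds 0) := by
    apply squeeze_zero_norm (a := fun n => ρ ^ n * |e - 0|)
    · intro n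
      exact S.prefixMap_dist d hd ρ h0 hρ n e 0
    · simpa using (tendsto_pow_atTop_nhds_zero_of_lt_one h0 h1).mul_const |e - 0|
  have ht : Tendsto (fun n => S.prefixMap d n e) atTop (nhds x) := by
    simpa using hz.add hx
  exact S.hEcpt.isClosed.mem_of_tendsto ht
    (Filter.Eventually.of_forall fun n => S.prefixMap_mem d hd n e he)

lemma E_sub_I (S : ClassE) {x : ℝ} (hx : x ∈ S.E) : x ∈ S.I :=
  ⟨csInf_le S.hEcpt.bddBelow hx, le_csSup S.hEcpt.bddAbove hx⟩

lemma a_mem (S : ClassE) : S.a ∈ S.E := S.hEcpt.sInf_mem S.hEne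
lemma b_mem (S : ClassE) : S.b ∈ S.E := S.hEcpt.sSup_mem S.hEne

lemma f_mem_I (S : ClassE) {i : ℕ} (hi : 1 ≤ i) (hi' : i ≤ S.m) {x : ℝ} (hx : x ∈ S.I) :
    S.f i x ∈ S.I := by
  have hr := (S.hr i hi hi').1
  have h1 := (S.E_sub_I (S.f_mem_E hi hi' S.a_mem)).1
  have h2 := (S.E_sub_I (S.f_mem_E hi hi' S.b_mem)).2
  unfold f at *
  exact ⟨by nlinarith [hx.1], by nlinarith [hx.2]⟩

lemma f_inj (S : ClassE) {i : ℕ} (hi : 1 ≤ i) (hi' : i ≤ S.m) : Function.Injective (S.f i) := by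
  intro x y h
  have hr := (S.hr i hi hi').1
  unfold f at h
  have : S.r i * (x - y) = 0 := by linarith
  rcases mul_eq_zero.1 this with h | h <;> linarith

/-- all codings of a point come from first digits `i` with the point in `f i '' I` -/
lemma coding_cases (S : ClassE) {d : ℕ → ℕ} {x : ℝ} (h : S.isCoding d x) :
    ∃ y ∈ S.I, S.f (d 0) y = x ∧ S.isCoding (fun n => d (n + 1)) y := by
  have hr := (S.hr _ (h.1 0).1 (h.1 0).2).1
  have e : S.f (d 0) ((x - S.t (d 0)) / S.r (d 0)) = x := by
    unfold f; field_simp; ring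
  have hc : S.isCoding (fun n => d (n + 1)) ((x - S.t (d 0)) / S.r (d 0)) := by
    rw [← S.isCoding_tcons (d 0) (h.1 0).1 (h.1 0).2, tcons_eta, e]
    exact h
  exact ⟨_, S.E_sub_I (S.isCoding_mem hc), e, hc⟩

lemma card_iso (S : ClassE) {i : ℕ} (hi : 1 ≤ i) (hi' : i ≤ S.m) {y : ℝ}
    (hiso : ∀ j, 1 ≤ j → j ≤ S.m → j ≠ i → S.f i y ∉ S.f j '' S.I) :
    Cardinal.mk (S.codings (S.f i y)) = Cardinal.mk (S.codings y) := by
  have : S.codings (S.f i y) = tcons i '' S.codings y := by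
    ext d
    constructor
    · intro h
      have h : S.isCoding d _ := h
      obtain ⟨z, hz, e, hc⟩ := S.coding_cases h
      have hd : d 0 = i := by
        by_contra hne
        exact hiso _ (h.1 0).1 (h.1 0).2 hne ⟨z, hz, e⟩
      refine ⟨_, ?_, by rw [← hd]; exact tcons_eta d⟩
      rw [hd] at e
      rw [S.f_inj hi hi' e] at hc
      exact hc
    · rintro ⟨c, hc, rfl⟩
      exact (S.isCoding_tcons i hi hi' c y).2 hc
  rw [this, Cardinal.mk_image_eq (tcons_inj i)]

lemma card_two (S : ClassE) {i j : ℕ} (hi : 1 ≤ i) (hi' : i ≤ S.m) (hj : 1 ≤ j) (hj' : j ≤ S.m)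
    (hij : i ≠ j) {y z : ℝ} (hyz : S.f i y = S.f j z)
    (hiso : ∀ l, 1 ≤ l → l ≤ S.m → l ≠ i → l ≠ j → S.f i y ∉ S.f l '' S.I) :
    Cardinal.mk (S.codings (S.f i y)) = Cardinal.mk (S.codings y) + Cardinal.mk (S.codings z) := by
  have : S.codings (S.f i y) = tcons i '' S.codings y ∪ tcons j '' S.codings z := by
    ext d
    constructor
    · intro h
      have h : S.isCoding d _ := h
      obtain ⟨w, hw, e, hc⟩ := S.coding_cases h
      by_cases hd : d 0 = i
      · left
        refine ⟨_, ?_, by rw [← hd]; exact tcons_eta d⟩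
        rw [hd] at e
        rw [S.f_inj hi hi' e] at hc
        exact hc
      by_cases hd' : d 0 = j
      · right
        refine ⟨_, ?_, by rw [← hd']; exact tcons_eta d⟩
        rw [hd', hyz] at e
        rw [S.f_inj hj hj' e] at hc
        exact hc
      exact absurd ⟨w, hw, e⟩ (hiso _ (h.1 0).1 (h.1 0).2 hd hd')
    · rintro (⟨c, hc, rfl⟩ | ⟨c, hc, rfl⟩)
      · exact (S.isCoding_tcons i hi hi' c y).2 hc
      · rw [hyz]
        exact (S.isCoding_tcons j hj hj' c z).2 hc
  rw [this, Cardinal.mk_union_of_disjoint, Cardinal.mk_image_eq (tcons_inj i),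
    Cardinal.mk_image_eq (tcons_inj j)]
  rw [Set.disjoint_left]
  rintro _ ⟨c, _, rfl⟩ ⟨c', _, h⟩
  exact hij (congrFun h 0).symm

lemma iter_affine (S : ClassE) {i : ℕ} (hi : 1 ≤ i) (hi' : i ≤ S.m) (n : ℕ) :
    ∃ p q : ℝ, 0 < p ∧ p = S.r i ^ n ∧ ∀ x, (S.f i)^[n] x = p * x + q := by
  have hr := (S.hr i hi hi').1
  induction n with
  | zero => exact ⟨1, 0, by simp⟩
  | succ n ih =>
    obtain ⟨p, q, hp, hpe, h⟩ := ih
    refine ⟨S.r i * p, S.r i * q + S.t i, by positivity, by rw [hpe]; ring, fun x => ?_⟩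
    rw [Function.iterate_succ_apply', h]
    unfold f
    ring

lemma affine_eq {p q p' q' a b : ℝ} (hp : 0 < p) (hp' : 0 < p') (hab : a < b)
    (h : (fun x => p * x + q) '' Icc a b = (fun x => p' * x + q') '' Icc a b) (x : ℝ) :
    p * x + q = p' * x + q' := by
  rw [Set.image_affine_Icc' hp, Set.image_affine_Icc' hp'] at h
  have hle : p * a + q ≤ p * b + q := by nlinarith
  have hle' : p' * a + q' ≤ p' * b + q' := by nlinarith
  obtain ⟨h1, h2⟩ := (Set.Icc_eq_Icc_iff hle).1 h
  have hpp : p = p' := by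
    have : (p - p') * (b - a) = 0 := by linarith
    rcases mul_eq_zero.1 this with h | h <;> linarith
  subst hpp
  linarith

lemma dimH_affine (p q : ℝ) (s : Set ℝ) : dimH ((fun x => p * x + q) '' s) ≤ dimH s := by
  have : LipschitzWith (Real.nnabs p) (fun x => p * x + q) := by
    apply LipschitzWith.of_dist_le_mul
    intro x y
    rw [Real.dist_eq, Real.dist_eq, Real.coe_nnabs, ← abs_mul]
    apply le_of_eq
    congr 1
    ring
  exact this.dimH_image_le s

lemma dimH_affine' {p q : ℝ} (hp : 0 < p) (s : Set ℝ) :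
    dimH s ≤ dimH ((fun x => p * x + q) '' s) := by
  have h := dimH_affine p⁻¹ (-q / p) ((fun x => p * x + q) '' s)
  rw [Set.image_image] at h
  have e : (fun x : ℝ => p⁻¹ * (p * x + q) + -q / p) = id := by
    funext x
    simp only [id]
    field_simp
    ring
  rwa [e, Set.image_id] at h

section
variable (S : ClassE) (hS : S.goodE)

lemma a_lt_b (hS : S.goodE) : S.a < S.b := by
  have h := hS.1.2.2.1
  have hr := (S.hr S.m (by have := S.hm; omega) le_rfl).1
  unfold f at h
  nlinarith

lemma fa_mono (hS : S.goodE) {i j : ℕ} (hi : 1 ≤ i) (hij : i ≤ j) (hj : j ≤ S.m) :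
    S.f i S.a ≤ S.f j S.a := by
  induction j, hij using Nat.le_induction with
  | base => exact le_rfl
  | succ j hij ih => exact (ih (by omega)).trans (hS.1.2.1 j (by omega) (by omega)).le

lemma f_le (S : ClassE) {i : ℕ} (hi : 1 ≤ i) (hi' : i ≤ S.m) {x y : ℝ} (h : x ≤ y) :
    S.f i x ≤ S.f i y := by
  have hr := (S.hr i hi hi').1
  unfold f
  nlinarith

lemma f_surj_Icc (S : ClassE) {i : ℕ} (hi : 1 ≤ i) (hi' : i ≤ S.m) {x : ℝ}
    (h1 : S.f i S.a ≤ x) (h2 : x ≤ S.f i S.b) : x ∈ S.f i '' S.I := by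
  have hr := (S.hr i hi hi').1
  have e : S.f i ((x - S.t i) / S.r i) = x := by
    unfold f; field_simp; ring
  unfold f at h1 h2
  refine ⟨_, ⟨?_, ?_⟩, e⟩
  · rw [le_div_iff₀ hr]; linarith
  · rw [div_le_iff₀ hr]; linarith

lemma far (hS : S.goodE) {i j : ℕ} (hi : 1 ≤ i) (hij : i + 2 ≤ j) (hj : j ≤ S.m) {x y : ℝ}
    (hx : x ∈ S.I) (hy : y ∈ S.I) : S.f i x < S.f j y := by
  have hb : S.f i S.b < S.f (i + 2) S.a := by
    by_contra hcon
    push Not at hcon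
    have hmem : S.f (i + 2) S.a ∈ S.f i '' S.I ∩ S.f (i + 2) '' S.I :=
      ⟨S.f_surj_Icc hi (by omega) (S.fa_mono hS hi (by omega) (by omega)) hcon,
        ⟨_, S.E_sub_I S.a_mem, rfl⟩⟩
    rw [hS.2.1 i hi (by omega)] at hmem
    exact hmem
  calc S.f i x ≤ S.f i S.b := S.f_le hi (by omega) hx.2
    _ < S.f (i + 2) S.a := hb
    _ ≤ S.f j S.a := S.fa_mono hS (by omega) hij hj
    _ ≤ S.f j y := S.f_le (by omega) hj hy.1

lemma m_iso (hS : S.goodE) (h2 : S.f (S.m - 1) '' S.I ∩ S.f S.m '' S.I = ∅) {y : ℝ}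
    (hy : y ∈ S.I) (j : ℕ) (hj : 1 ≤ j) (hj' : j ≤ S.m) (hne : j ≠ S.m) :
    S.f S.m y ∉ S.f j '' S.I := by
  intro hmem
  by_cases h : j = S.m - 1
  · subst h
    have : S.f S.m y ∈ S.f (S.m - 1) '' S.I ∩ S.f S.m '' S.I := ⟨hmem, y, hy, rfl⟩
    rw [h2] at this
    exact this
  · obtain ⟨z, hz, e⟩ := hmem
    exact absurd e (S.far hS hj (by omega) le_rfl hz hy).ne

lemma iter_mem_I {i : ℕ} (hi : 1 ≤ i) (hi' : i ≤ S.m) (n : ℕ) {x : ℝ} (hx : x ∈ S.I) :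
    (S.f i)^[n] x ∈ S.I := by
  induction n with
  | zero => exact hx
  | succ n ih => rw [Function.iterate_succ_apply']; exact S.f_mem_I hi hi' ih

lemma iter_mem_E {i : ℕ} (hi : 1 ≤ i) (hi' : i ≤ S.m) (n : ℕ) {x : ℝ} (hx : x ∈ S.E) :
    (S.f i)^[n] x ∈ S.E := by
  induction n with
  | zero => exact hx
  | succ n ih => rw [Function.iterate_succ_apply']; exact S.f_mem_E hi hi' ih

lemma card_m (hS : S.goodE) (h2 : S.f (S.m - 1) '' S.I ∩ S.f S.m '' S.I = ∅) (n : ℕ) {y : ℝ}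
    (hy : y ∈ S.I) :
    Cardinal.mk (S.codings ((S.f S.m)^[n] y)) = Cardinal.mk (S.codings y) := by
  have hm := S.hm
  induction n with
  | zero => rfl
  | succ n ih =>
    rw [Function.iterate_succ_apply', S.card_iso (by omega) le_rfl, ih]
    exact S.m_iso hS h2 (S.iter_mem_I (by omega) le_rfl n hy)

lemma main_card (hS : S.goodE) (h1 : S.f 1 '' S.I ∩ S.f 2 '' S.I ≠ ∅)
    (h2 : S.f (S.m - 1) '' S.I ∩ S.f S.m '' S.I = ∅) :
    ∃ u : ℕ, ∀ q : ℕ, ∀ z ∈ S.I, z ∉ S.f S.m '' S.I →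
      Cardinal.mk (S.codings (S.f 1 ((S.f S.m)^[q * u] z)))
        = (q + 1 : ℕ) * Cardinal.mk (S.codings z) := by
  have hm := S.hm
  have hab := S.a_lt_b hS
  obtain ⟨u, v, hu, hv, e1, e2⟩ := hS.2.2.2 1 le_rfl (by omega) h1
  rw [show 1 + 1 = 2 from rfl] at e1 e2
  -- equality of maps
  have hmaps : ∀ x, S.f 1 ((S.f S.m)^[u] x) = S.f 2 ((S.f 1)^[v] x) := by
    obtain ⟨p, q, hp, -, hpq⟩ := S.iter_affine (i := S.m) (by omega) le_rfl u
    obtain ⟨p', q', hp', -, hpq'⟩ := S.iter_affine (i := 1) le_rfl (by omega) v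
    have r1 := (S.hr 1 le_rfl (by omega)).1
    have r2 := (S.hr 2 (by omega) (by omega)).1
    have g1 : ∀ x, S.f 1 ((S.f S.m)^[u] x) = (S.r 1 * p) * x + (S.r 1 * q + S.t 1) := by
      intro x; rw [hpq]; unfold f; ring
    have g2 : ∀ x, S.f 2 ((S.f 1)^[v] x) = (S.r 2 * p') * x + (S.r 2 * q' + S.t 2) := by
      intro x; rw [hpq']; unfold f; ring
    intro x
    rw [g1, g2]
    refine affine_eq (by positivity) (by positivity) hab ?_ x
    have e3 := e1.symm.trans e2
    have k1 : (S.f 1 ∘ (S.f S.m)^[u]) = fun x => (S.r 1 * p) * x + (S.r 1 * q + S.t 1) :=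
      funext g1
    have k2 : (S.f 2 ∘ (S.f 1)^[v]) = fun x => (S.r 2 * p') * x + (S.r 2 * q' + S.t 2) :=
      funext g2
    rw [k1, k2] at e3
    exact e3
  have hfm : ∀ n, 1 ≤ n → ∀ x ∈ S.I, (S.f S.m)^[n] x ∈ S.f S.m '' S.I := by
    intro n hn x hx
    obtain ⟨k, rfl⟩ : ∃ k, n = k + 1 := ⟨n - 1, by omega⟩
    rw [Function.iterate_succ_apply']
    exact ⟨_, S.iter_mem_I (by omega) le_rfl k hx, rfl⟩
  have N1 : ∀ y ∈ S.I, y ∉ S.f S.m '' S.I →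
      Cardinal.mk (S.codings (S.f 1 y)) = Cardinal.mk (S.codings y) := by
    intro y hy hym
    refine S.card_iso le_rfl (by omega) ?_
    intro j hj hj' hne hmem
    by_cases h : j = 2
    · subst h
      have hmem2 : S.f 1 y ∈ S.f 1 '' S.I ∩ S.f 2 '' S.I := ⟨⟨y, hy, rfl⟩, hmem⟩
      rw [e1] at hmem2
      obtain ⟨w, hw, ew⟩ := hmem2
      have := S.f_inj le_rfl (by omega) ew
      exact hym (this ▸ hfm u hu w hw)
    · obtain ⟨z, hz, e⟩ := hmem
      exact absurd e.symm (S.far hS le_rfl (by omega) hj' hy hz).ne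
  have N1v : ∀ n y, y ∈ S.I →
      Cardinal.mk (S.codings ((S.f 1)^[n + 1] y)) = Cardinal.mk (S.codings (S.f 1 y)) := by
    intro n y hy
    induction n with
    | zero => rfl
    | succ n ih =>
      rw [Function.iterate_succ_apply', N1 _ (S.iter_mem_I le_rfl (by omega) _ hy), ih]
      rw [Function.iterate_succ_apply']
      rintro ⟨z, hz, e⟩
      exact absurd e.symm
        (S.far hS le_rfl (by omega) le_rfl (S.iter_mem_I le_rfl (by omega) n hy) hz).ne
  refine ⟨u, fun q z hz hzm => ?_⟩
  induction q with
  | zero => simpa using N1 z hz hzm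
  | succ q ih =>
    have hw := S.iter_mem_I (i := S.m) (by omega) le_rfl (q * u) hz
    have hsplit : (S.f S.m)^[(q + 1) * u] z = (S.f S.m)^[u] ((S.f S.m)^[q * u] z) := by
      rw [← Function.iterate_add_apply]; congr 1; ring
    rw [hsplit, S.card_two le_rfl (by omega) (by omega : 1 ≤ 2) (by omega) (by omega)
      (hmaps ((S.f S.m)^[q * u] z)), ← hsplit, S.card_m hS h2 _ hz]
    · obtain ⟨k, rfl⟩ : ∃ k, v = k + 1 := ⟨v - 1, by omega⟩
      rw [N1v _ _ hw, ih]
      push_cast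
      ring
    · rintro l hl hl' hl1 hl2 ⟨y, hy, e⟩
      exact absurd e.symm
        (S.far hS le_rfl (by omega) hl' (S.iter_mem_I (by omega) le_rfl u hw) hy).ne

lemma U1_cover (hS : S.goodE) (h2 : S.f (S.m - 1) '' S.I ∩ S.f S.m '' S.I = ∅) :
    S.U 1 ⊆ {S.b} ∪ ⋃ n : ℕ, (S.f S.m)^[n] '' (S.U 1 \ S.f S.m '' S.I) := by
  have hm := S.hm
  intro x hx
  by_contra hcon
  simp only [Set.mem_union, Set.mem_singleton_iff, Set.mem_iUnion, not_or, not_exists] at hcon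
  obtain ⟨hxb, hno⟩ := hcon
  have key : ∀ n, ∃ y ∈ S.U 1, (S.f S.m)^[n] y = x := by
    intro n
    induction n with
    | zero => exact ⟨x, hx, rfl⟩
    | succ n ih =>
      obtain ⟨y, hy, e⟩ := ih
      have hym : y ∈ S.f S.m '' S.I := by
        by_contra h
        exact hno n ⟨y, ⟨hy, h⟩, e⟩
      obtain ⟨w, hw, ew⟩ := hym
      obtain ⟨i, hi, hi', z, hz, ez⟩ := S.mem_E_cases hy.1
      have him : i = S.m := by
        by_contra hne
        refine S.m_iso hS h2 hw i hi hi' hne ?_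
        rw [ew]
        exact ⟨z, S.E_sub_I hz, ez⟩
      subst him
      refine ⟨z, ⟨hz, ?_⟩, ?_⟩
      · have := S.card_m hS h2 1 (S.E_sub_I hz)
        rw [← this]
        simp only [Function.iterate_one, ez]
        exact hy.2
      · rw [Function.iterate_succ_apply, ez, e]
  apply hxb
  have hr := S.hr S.m (by omega) le_rfl
  have hfix : ∀ n, (S.f S.m)^[n] S.b = S.b := fun n =>
    Function.iterate_fixed hS.1.2.2.2 n
  have hbound : ∀ n : ℕ, |x - S.b| ≤ S.r S.m ^ n * (S.b - S.a) := by
    intro n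
    obtain ⟨y, hy, e⟩ := key n
    obtain ⟨p, q, hp, hpe, h⟩ := S.iter_affine (i := S.m) (by omega) le_rfl n
    have hyI := S.E_sub_I hy.1
    have hb := hfix n
    rw [h] at hb e
    have : x - S.b = p * (y - S.b) := by linarith
    rw [this, abs_mul, abs_of_pos hp, ← hpe]
    apply mul_le_mul_of_nonneg_left _ hp.le
    rw [abs_le]
    exact ⟨by linarith [hyI.1], by linarith [hyI.2, S.a_lt_b hS]⟩
  have hlim : Tendsto (fun n : ℕ => S.r S.m ^ n * (S.b - S.a)) atTop (nhds 0) := by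
    simpa using (tendsto_pow_atTop_nhds_zero_of_lt_one hr.1.le hr.2).mul_const (S.b - S.a)
  have h0 : |x - S.b| ≤ 0 := ge_of_tendsto' hlim hbound
  have := abs_nonpos_iff.1 h0
  linarith

end

end ClassE

open ClassE

theorem stmt9 (S : ClassE) (hS : S.goodE)
    (h1 : S.f 1 '' S.I ∩ S.f 2 '' S.I ≠ ∅)
    (h2 : S.f (S.m - 1) '' S.I ∩ S.f S.m '' S.I = ∅) :
    ∀ k : ℕ, 1 ≤ k → dimH (S.U 1) ≤ dimH (S.U k) := by
  intro k hk
  have hm := S.hm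
  have hA : dimH (S.U 1) ≤ dimH (S.U 1 \ S.f S.m '' S.I) := by
    refine (dimH_mono (S.U1_cover hS h2)).trans ?_
    rw [dimH_union, dimH_singleton, dimH_iUnion]
    refine max_le zero_le (iSup_le fun n => ?_)
    obtain ⟨p, q, hp, -, h⟩ := S.iter_affine (i := S.m) (by omega) le_rfl n
    rw [funext h]
    exact dimH_affine p q _
  refine hA.trans ?_
  obtain ⟨u, hu⟩ := S.main_card hS h1 h2
  obtain ⟨p, q, hp, -, h⟩ := S.iter_affine (i := S.m) (by omega) le_rfl ((k - 1) * u)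
  have r1 := (S.hr 1 le_rfl (by omega)).1
  refine (dimH_affine' (p := S.r 1 * p) (q := S.r 1 * q + S.t 1) (by positivity) _).trans
    (dimH_mono ?_)
  rintro _ ⟨z, ⟨hz, hzm⟩, rfl⟩
  have e : (fun x => S.r 1 * p * x + (S.r 1 * q + S.t 1)) z
      = S.f 1 ((S.f S.m)^[(k - 1) * u] z) := by
    rw [h]
    simp only [ClassE.f]
    ring
  rw [e]
  refine ⟨S.f_mem_E le_rfl (by omega) (S.iter_mem_E (by omega) le_rfl _ hz.1), ?_⟩
  rw [hu (k - 1) z (S.E_sub_I hz.1) hzm, hz.2, mul_one]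
  congr 1
  omega
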